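/- arXiv:1805.08049 — 2 statements merged into one kernel-verified Lean document; each statement's English description precedes it below -/
import Mathlib

section
/- Let O' be an integral domain, p a prime number, h ≥ 1, q = p^h, e ≥ 1 an integer, and let ϖ, π ∈ O' be elements with ϖ ≠ 0, p ∈ ϖO', π ∈ ϖO', and a^q ≡ a (mod ϖO') for every a ∈ O'. Consider the polynomial ring O'[X_{n,i} : n ≥ 0, 0 ≤ i ≤ e−1]. Then there exists a unique sequence of polynomials (u^{ra}_m)_{m ≥ 0} in this ring such that Φ^{(ϖ,q)}_m(u^{ra}_0, …, u^{ra}_m) = Σ_{j=0}^{e−1} ϖ^j · Φ^{(π,q)}_m(X_{0,j}, X_{1,j}, …, X_{m,j}) for all m ≥ 0. -/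
open MvPolynomial

/-- The `n`-th ramified Witt polynomial with respect to `(π, q)`,
evaluated at a sequence `b`: `Φ^{(π,q)}_n(b) = ∑_{i=0}^{n} π^i b_i^{q^{n-i}}`. -/
def wittPhi {R : Type*} [CommRing R] (π : R) (q : ℕ) (n : ℕ) (b : ℕ → R) : R :=
  ∑ i ∈ Finset.range (n + 1), π ^ i * b i ^ q ^ (n - i)

/-- If `t` divides `p` and `a - b`, then `t ^ (k + 1)` divides `a ^ p ^ k - b ^ p ^ k`. -/
theorem pow_succ_dvd_sub_pow_prime_pow {A : Type*} [CommRing A] {t a b : A} {p : ℕ}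
    (hp : t ∣ (p : A)) (h : t ∣ a - b) (k : ℕ) :
    t ^ (k + 1) ∣ a ^ p ^ k - b ^ p ^ k := by
  induction k with
  | zero => simpa using h
  | succ k ih =>
    rw [pow_succ p k, pow_mul, pow_mul, ← (Commute.all (a ^ p ^ k) (b ^ p ^ k)).geom_sum₂_mul,
      pow_succ' t (k + 1)]
    refine mul_dvd_mul ?_ ih
    let f := Ideal.Quotient.mk (Ideal.span {t})
    have hf (x : A) : f x = 0 ↔ t ∣ x := by
      rw [Ideal.Quotient.eq_zero_iff_mem, Ideal.mem_span_singleton]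
    have hab : f (a ^ p ^ k) = f (b ^ p ^ k) := by
      rw [← sub_eq_zero, ← map_sub, hf]
      exact h.trans (sub_dvd_pow_sub_pow a b _)
    rw [← hf, RingHom.map_geom_sum₂, hab, geom_sum₂_self, ← map_natCast f, (hf _).2 hp, zero_mul]

/-- If every constant satisfies `a ^ q ≡ a` modulo `t`, then the `q`-th power of a polynomial is
congruent modulo `t` to its expansion by `q`. -/
theorem C_dvd_pow_sub_expand {σ R : Type*} [CommRing R] {t : R} {p : ℕ} (hp : p.Prime) (h : ℕ)
    (htp : t ∣ (p : R)) (hR : ∀ a : R, t ∣ a ^ p ^ h - a) (f : MvPolynomial σ R) :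
    C t ∣ f ^ p ^ h - expand (p ^ h) f := by
  induction f using MvPolynomial.induction_on with
  | C a =>
    rw [expand_C, ← C_pow, ← C_sub]
    exact map_dvd C (hR a)
  | add f g hf hg =>
    obtain ⟨r, hr⟩ := exists_add_pow_prime_pow_eq hp f g h
    have hCp : C t ∣ (p : MvPolynomial σ R) := by
      simpa using map_dvd (C : R →+* MvPolynomial σ R) htp
    rw [hr, map_add]
    convert dvd_add (dvd_add hf hg) (hCp.mul_right (f * g * r)) using 1
    ring
  | mul_X f i hf =>
    rw [mul_pow, map_mul, expand_X, ← sub_mul]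
    exact hf.mul_right _

/-- The sequence whose ramified Witt polynomials with respect to `(t, q)` are the terms of `R`,
whenever such a sequence exists and `t` is cancellable. -/
noncomputable def wittSolve {A : Type*} [CommRing A] (t : A) (q : ℕ) (R : ℕ → A) : ℕ → A
  | m => Classical.epsilon fun x =>
      t ^ m * x = R m - ∑ i : Fin m, t ^ (i : ℕ) * wittSolve t q R i ^ q ^ (m - i)
  decreasing_by exact i.2

theorem wittPhi_succ {A : Type*} [CommRing A] (t : A) (q m : ℕ) (b : ℕ → A) :
    wittPhi t q (m + 1) b = wittPhi t q m (fun i => b i ^ q) + t ^ (m + 1) * b (m + 1) := by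
  rw [wittPhi, Finset.sum_range_succ, wittPhi]
  congr 1
  · refine Finset.sum_congr rfl fun i hi => ?_
    rw [← pow_mul, ← pow_succ', Nat.sub_add_comm (Finset.mem_range_succ_iff.1 hi)]
  · simp

theorem map_wittPhi {A B F : Type*} [CommRing A] [CommRing B] [FunLike F A B] [RingHomClass F A B]
    (φ : F) (t : A) (q m : ℕ) (b : ℕ → A) :
    φ (wittPhi t q m b) = wittPhi (φ t) q m (fun i => φ (b i)) := by
  simp [wittPhi]

/-- Congruent sequences modulo `t` have congruent ramified Witt polynomials. -/
theorem pow_succ_dvd_wittPhi_sub {A : Type*} [CommRing A] {t : A} {p h : ℕ} (hh : 1 ≤ h)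
    (htp : t ∣ (p : A)) (m : ℕ) {a b : ℕ → A} (hab : ∀ i, t ∣ a i - b i) :
    t ^ (m + 1) ∣ wittPhi t (p ^ h) m a - wittPhi t (p ^ h) m b := by
  rw [wittPhi, wittPhi, ← Finset.sum_sub_distrib]
  refine Finset.dvd_sum fun i hi => ?_
  have him := Finset.mem_range_succ_iff.1 hi
  rw [← mul_sub, ← pow_mul, show m + 1 = i + (m - i + 1) by omega, pow_add]
  refine mul_dvd_mul_left _ ((pow_dvd_pow t ?_).trans
    (pow_succ_dvd_sub_pow_prime_pow htp (hab i) (h * (m - i))))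
  exact Nat.succ_le_succ (Nat.le_mul_of_pos_left _ hh)

/-- Dwork's lemma: given a lift `φ` of the `q`-power map modulo `t`, a sequence `R` with
`R (m + 1) ≡ φ (R m)` modulo `t ^ (m + 1)` consists of the ramified Witt polynomials of some
sequence. -/
theorem exists_wittPhi_eq {A : Type*} [CommRing A] {t : A} {p h : ℕ} (hh : 1 ≤ h)
    (htp : t ∣ (p : A)) (φ : A →+* A) (hφt : φ t = t) (hφ : ∀ f, t ∣ f ^ p ^ h - φ f)
    (R : ℕ → A) (hR : ∀ m, t ^ (m + 1) ∣ R (m + 1) - φ (R m)) :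
    ∃ u : ℕ → A, ∀ m, wittPhi t (p ^ h) m u = R m := by
  let u := wittSolve t (p ^ h) R
  have key (m : ℕ) (hm : t ^ m ∣ R m - ∑ i ∈ Finset.range m, t ^ i * u i ^ (p ^ h) ^ (m - i)) :
      wittPhi t (p ^ h) m u = R m := by
    obtain ⟨x, hx⟩ := hm
    rw [← Fin.sum_univ_eq_sum_range (fun i => t ^ i * u i ^ (p ^ h) ^ (m - i))] at hx
    have hu : t ^ m * u m = R m - ∑ i : Fin m, t ^ (i : ℕ) * u i ^ (p ^ h) ^ (m - i) := by
      have := Classical.epsilon_spec (p := fun x => t ^ m * x =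
        R m - ∑ i : Fin m, t ^ (i : ℕ) * u i ^ (p ^ h) ^ (m - i)) ⟨x, hx.symm⟩
      rwa [← wittSolve] at this
    rw [wittPhi, Finset.sum_range_succ, Nat.sub_self, pow_zero, pow_one, hu,
      ← Fin.sum_univ_eq_sum_range (fun i => t ^ i * u i ^ (p ^ h) ^ (m - i)),
      add_sub_cancel]
  refine ⟨u, fun m => ?_⟩
  induction m with
  | zero => exact key 0 (by simp)
  | succ m ih =>
    refine key (m + 1) ?_
    have hsum : ∑ i ∈ Finset.range (m + 1), t ^ i * u i ^ (p ^ h) ^ (m + 1 - i) =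
        wittPhi t (p ^ h) m (fun i => u i ^ p ^ h) := by
      have := wittPhi_succ t (p ^ h) m u
      rw [wittPhi, Finset.sum_range_succ] at this
      simpa using this
    have h₁ := hR m
    rw [← ih, map_wittPhi, hφt] at h₁
    have h₂ := pow_succ_dvd_wittPhi_sub hh htp m (fun i => hφ (u i))
    rw [hsum]
    convert dvd_sub h₁ h₂ using 1
    ring

theorem wittPhi_injective {A : Type*} [CommRing A] [IsDomain A] {t : A} (ht : t ≠ 0) (q : ℕ)
    {u v : ℕ → A} (huv : ∀ m, wittPhi t q m u = wittPhi t q m v) : u = v := by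
  funext m
  induction m using Nat.strong_induction_on with
  | _ m ih =>
    have := huv m
    rw [wittPhi, wittPhi, Finset.sum_range_succ, Finset.sum_range_succ,
      Finset.sum_congr rfl fun i hi => by rw [ih i (Finset.mem_range.1 hi)]] at this
    simpa [ht] using this

theorem stmt_8 {O' : Type*} [CommRing O'] [IsDomain O'] (p : ℕ) (hp : p.Prime)
    (h : ℕ) (hh : 1 ≤ h) (q : ℕ) (hq : q = p ^ h) (e : ℕ) (he : 1 ≤ e)
    (ϖ π : O') (hϖ : ϖ ≠ 0)
    (hpϖ : (p : O') ∈ Ideal.span {ϖ}) (hπϖ : π ∈ Ideal.span {ϖ})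
    (hO : ∀ a : O', a ^ q - a ∈ Ideal.span {ϖ}) :
    ∃! u : ℕ → MvPolynomial (ℕ × Fin e) O',
      ∀ m : ℕ, wittPhi (MvPolynomial.C ϖ) q m u
        = ∑ j : Fin e, (MvPolynomial.C ϖ : MvPolynomial (ℕ × Fin e) O') ^ (j : ℕ) *
            wittPhi (MvPolynomial.C π) q m (fun n => MvPolynomial.X (n, j)) := by
  subst hq
  simp only [Ideal.mem_span_singleton] at hpϖ hπϖ hO
  have hC : (C ϖ : MvPolynomial (ℕ × Fin e) O') ≠ 0 := by simpa using hϖ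
  have hCp : (C ϖ : MvPolynomial (ℕ × Fin e) O') ∣ (p : MvPolynomial (ℕ × Fin e) O') := by
    simpa using map_dvd (C : O' →+* MvPolynomial (ℕ × Fin e) O') hpϖ
  obtain ⟨u, hu⟩ := exists_wittPhi_eq hh hCp
    (expand (p ^ h) : MvPolynomial (ℕ × Fin e) O' →ₐ[O'] _).toRingHom (expand_C _ _)
    (C_dvd_pow_sub_expand hp h hpϖ hO)
    (fun m => ∑ j : Fin e, (C ϖ : MvPolynomial (ℕ × Fin e) O') ^ (j : ℕ) *
      wittPhi (C π) (p ^ h) m (fun n => X (n, j))) (fun m => by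
        simp only [AlgHom.toRingHom_eq_coe, RingHom.coe_coe, map_sum, map_mul, map_pow, expand_C,
          map_wittPhi, expand_X, wittPhi_succ, mul_add, Finset.sum_add_distrib, add_sub_cancel_left]
        exact Finset.dvd_sum fun j _ => Dvd.dvd.mul_left
          ((pow_dvd_pow_of_dvd (map_dvd C hπϖ) _).mul_right _) _)
  exact ⟨u, hu, fun v hv => wittPhi_injective hC _ fun m => (hv m).trans (hu m).symm⟩
end

section
/- Let O' be an integral domain, π, ϖ ∈ O' nonzero elements, q ≥ 2 and r ≥ 1 integers. Let (F_n)_{n ≥ 0}, (F'_n)_{n ≥ 0}, (u_n)_{n ≥ 0} be sequences of polynomials in O'[X_0, X_1, X_2, …] satisfying, for all m ≥ 0: Φ^{(π,q)}_m(F_0, …, F_m) = Φ^{(π,q)}_{m+1}(X_0, …, X_{m+1}); Φ^{(ϖ,q^r)}_m(F'_0, …, F'_m) = Φ^{(ϖ,q^r)}_{m+1}(X_0, …, X_{m+1}); and Φ^{(ϖ,q^r)}_m(u_0, …, u_m) = Φ^{(π,q)}_{rm}(X_0, …, X_{rm}). Then u ∘ F^{∘r} = F' ∘ u as families: for every n ≥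 0, substituting (F^{∘r})_i for X_i in u_n yields the same polynomial as substituting u_i for X_i in F'_n. -/
open MvPolynomial

/-- Composite of two families of polynomials: `(g ∘ h)_n` is obtained by
substituting `h i` for `X i` in `g n`. -/
noncomputable def famComp {R : Type*} [CommRing R] (g h : ℕ → MvPolynomial ℕ R) : ℕ → MvPolynomial ℕ R :=
  fun n => MvPolynomial.aeval h (g n)

/-- The `r`-fold composite `g^{∘r}` of a family of polynomials with itself;
`g^{∘0}` is the identity family `(X_n)_n`. -/
noncomputable def famIter {R : Type*} [CommRing R] (g : ℕ → MvPolynomial ℕ R) : ℕ → ℕ → MvPolynomial ℕ R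
  | 0 => fun n => MvPolynomial.X n
  | r + 1 => famComp g (famIter g r)

theorem map_wittPhi_s10 {R S : Type*} [CommRing R] [CommRing S] (f : R →+* S) (π : R) (q n : ℕ)
    (b : ℕ → R) : f (wittPhi π q n b) = wittPhi (f π) q n (fun i => f (b i)) := by
  simp [wittPhi]

/-- Over a domain, with `π ≠ 0`, a sequence is determined by its ghost components. -/
theorem wittPhi_injective_s10 {R : Type*} [CommRing R] [IsDomain R] {π : R} (hπ : π ≠ 0) {q : ℕ}
    {b c : ℕ → R} (h : ∀ n, wittPhi π q n b = wittPhi π q n c) : b = c := by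
  funext n
  induction n using Nat.strong_induction_on with
  | _ n ih =>
    have hn := h n
    simp only [wittPhi, Finset.sum_range_succ, Nat.sub_self, pow_zero, pow_one] at hn
    rw [Finset.sum_congr rfl fun i hi => by rw [ih i (Finset.mem_range.1 hi)]] at hn
    exact mul_left_cancel₀ (pow_ne_zero n hπ) (add_left_cancel hn)

theorem wittPhi_famComp {R : Type*} [CommRing R] (π : R) (q n : ℕ) (g h : ℕ → MvPolynomial ℕ R) :
    wittPhi (C π) q n (famComp g h) = aeval h (wittPhi (C π) q n g) := by
  have := map_wittPhi_s10 (aeval h : MvPolynomial ℕ R →ₐ[R] MvPolynomial ℕ R).toRingHom (C π) q n g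
  simp only [AlgHom.toRingHom_eq_coe, RingHom.coe_coe, algHom_C, algebraMap_eq] at this
  exact this.symm

theorem aeval_wittPhi_X {R : Type*} [CommRing R] (π : R) (q n : ℕ) (h : ℕ → MvPolynomial ℕ R) :
    aeval h (wittPhi (C π) q n fun i => (X i : MvPolynomial ℕ R)) = wittPhi (C π) q n h := by
  have hX : famComp (fun i => X i) h = h := funext fun i => by rw [famComp, aeval_X]
  rw [← wittPhi_famComp, hX]

theorem wittPhi_famIter {R : Type*} [CommRing R] {π : R} {q : ℕ} {F : ℕ → MvPolynomial ℕ R}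
    (hF : ∀ m, wittPhi (C π) q m F = wittPhi (C π) q (m + 1) fun i => X i) (r m : ℕ) :
    wittPhi (C π) q m (famIter F r) = wittPhi (C π) q (m + r) fun i => X i := by
  induction r generalizing m with
  | zero => rfl
  | succ r ih =>
    rw [famIter, wittPhi_famComp, hF, aeval_wittPhi_X, ih, add_right_comm, add_assoc]

theorem stmt_10 {O' : Type*} [CommRing O'] [IsDomain O'] (π ϖ : O')
    (hπ : π ≠ 0) (hϖ : ϖ ≠ 0) (q r : ℕ) (hq : 2 ≤ q) (hr : 1 ≤ r)
    (F F' u : ℕ → MvPolynomial ℕ O')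
    (hF : ∀ m : ℕ, wittPhi (MvPolynomial.C π) q m F
        = wittPhi (MvPolynomial.C π) q (m + 1) (fun i => MvPolynomial.X i))
    (hF' : ∀ m : ℕ, wittPhi (MvPolynomial.C ϖ) (q ^ r) m F'
        = wittPhi (MvPolynomial.C ϖ) (q ^ r) (m + 1) (fun i => MvPolynomial.X i))
    (hu : ∀ m : ℕ, wittPhi (MvPolynomial.C ϖ) (q ^ r) m u
        = wittPhi (MvPolynomial.C π) q (r * m) (fun i => MvPolynomial.X i)) :
    ∀ n : ℕ, famComp u (famIter F r) n = famComp F' u n := by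
  refine congrFun (wittPhi_injective_s10 (q := q ^ r) ((C_ne_zero (σ := ℕ)).2 hϖ) fun m => ?_)
  rw [wittPhi_famComp, hu, aeval_wittPhi_X, wittPhi_famIter hF, wittPhi_famComp, hF',
    aeval_wittPhi_X, hu, Nat.mul_succ]
end
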